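/- Let ρ be a density matrix on ℂ^n with spectral decomposition ρ = Σ_j e_j E_j (E_j the orthogonal projection onto the eigenspace of eigenvalue e_j), and let X = {X_x} be an arbitrary discrete POVM on ℂ^n. Then max_x Tr[ρ X_x] ≤ max_{x, j : e_j > 0} λ_max(E_j X_x E_j); equivalently, the lower bound −log max_{x, j: e_j>0} λ_max(E_j X_x E_j) for the Rényi entropy never exceeds the min-entropy H_∞(X|ρ) = −log max_x Tr[ρX_x], with equality when ρ is pure. -/

import Mathlib

noncomputable section
open scoped BigOperators Classical ComplexOrder
open Matrix

namespace QC

/-- A density matrix: positive semidefinite with unit trace. -/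
def IsDensity {m : Type*} [Fintype m] [DecidableEq m] (ρ : Matrix m m ℂ) : Prop :=
  ρ.PosSemidef ∧ ρ.trace = 1

/-- A (discrete) POVM: positive semidefinite elements summing to the identity. -/
def IsPOVM {m ι : Type*} [Fintype m] [DecidableEq m] [Fintype ι]
    (X : ι → Matrix m m ℂ) : Prop :=
  (∀ x, (X x).PosSemidef) ∧ ∑ x, X x = 1

/-- A projective observable: mutually orthogonal Hermitian projections. -/
def IsProjective {m ι : Type*} [Fintype m] [DecidableEq m] [Fintype ι]
    (X : ι → Matrix m m ℂ) : Prop :=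
  (∀ x, (X x).IsHermitian) ∧ ∀ x x', X x * X x' = if x = x' then X x else 0

/-- Eigenvalues of a matrix (junk value `0` if not Hermitian). -/
noncomputable def eigs {m : Type*} [Fintype m] [DecidableEq m] (A : Matrix m m ℂ) : m → ℝ :=
  if h : A.IsHermitian then h.eigenvalues else 0

/-- Largest eigenvalue of a Hermitian matrix. -/
noncomputable def lamMax {m : Type*} [Fintype m] [DecidableEq m] (A : Matrix m m ℂ) : ℝ :=
  ⨆ i, eigs A i

/-- Real power of a Hermitian matrix, taken on its support (junk value `0` if not Hermitian).
Since `(0:ℝ) ^ r = 0` for `r ≠ 0`, the power is taken on the support. -/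
noncomputable def mpow {m : Type*} [Fintype m] [DecidableEq m]
    (A : Matrix m m ℂ) (r : ℝ) : Matrix m m ℂ :=
  if h : A.IsHermitian then
    (h.eigenvectorUnitary : Matrix m m ℂ) *
      Matrix.diagonal (fun i => ((h.eigenvalues i ^ r : ℝ) : ℂ)) *
      (star (h.eigenvectorUnitary : Matrix m m ℂ))
  else 0

/-- Logarithm of a Hermitian matrix, taken on its support. -/
noncomputable def mlog {m : Type*} [Fintype m] [DecidableEq m]
    (A : Matrix m m ℂ) : Matrix m m ℂ :=
  if h : A.IsHermitian then
    (h.eigenvectorUnitary : Matrix m m ℂ) *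
      Matrix.diagonal (fun i => ((Real.log (h.eigenvalues i) : ℝ) : ℂ)) *
      (star (h.eigenvectorUnitary : Matrix m m ℂ))
  else 0

/-- Support inclusion of matrices (as linear maps). -/
def suppLE {m : Type*} [Fintype m] [DecidableEq m] (ρ σ : Matrix m m ℂ) : Prop :=
  LinearMap.range (Matrix.toLin' ρ) ≤ LinearMap.range (Matrix.toLin' σ)

/-- Quantum relative entropy `Tr[ρ (log ρ - log σ)]` (finite part). -/
noncomputable def relEnt {m : Type*} [Fintype m] [DecidableEq m]
    (ρ σ : Matrix m m ℂ) : ℝ :=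
  ((ρ * (mlog ρ - mlog σ)).trace).re

/-- `Tr[(σ^{(1-α)/(2α)} ρ σ^{(1-α)/(2α)})^α]`, computed via eigenvalues. -/
noncomputable def sandTr {m : Type*} [Fintype m] [DecidableEq m]
    (α : ℝ) (ρ σ : Matrix m m ℂ) : ℝ :=
  ∑ i, (eigs (mpow σ ((1 - α) / (2 * α)) * ρ * mpow σ ((1 - α) / (2 * α))) i) ^ α

/-- Sandwiched Rényi divergence, `+∞` when `α ≥ 1` and the support of `ρ` is not
contained in that of `σ`; `D_1` is the quantum relative entropy. -/
noncomputable def Dren {m : Type*} [Fintype m] [DecidableEq m]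
    (α : ℝ) (ρ σ : Matrix m m ℂ) : EReal :=
  if 1 ≤ α ∧ ¬ suppLE ρ σ then ⊤
  else if α = 1 then ((relEnt ρ σ : ℝ) : EReal)
  else (((α - 1)⁻¹ * Real.log (sandTr α ρ σ) : ℝ) : EReal)

/-- Outcome distribution `p(x|ρ) = Tr(ρ X_x)`. -/
noncomputable def probOf {m ι : Type*} [Fintype m] [DecidableEq m]
    (ρ : Matrix m m ℂ) (X : ι → Matrix m m ℂ) (x : ι) : ℝ :=
  ((ρ * X x).trace).re

/-- Rényi entropy of a distribution (`α = 1` gives the Shannon entropy). -/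
noncomputable def renyiH {ι : Type*} [Fintype ι] (α : ℝ) (p : ι → ℝ) : ℝ :=
  if α = 1 then ∑ x, Real.negMulLog (p x)
  else (1 - α)⁻¹ * Real.log (∑ x, (p x) ^ α)

/-- Pinching `σ_X := Σ_x X_x σ X_x`. -/
noncomputable def pinch {m ι : Type*} [Fintype m] [DecidableEq m] [Fintype ι]
    (X : ι → Matrix m m ℂ) (σ : Matrix m m ℂ) : Matrix m m ℂ :=
  ∑ x, X x * σ * X x

/-- Rényi asymmetry of a projective observable:
`Q_α(X|ρ) = inf_σ D_α(ρ ‖ σ_X)` over density matrices `σ`. -/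
noncomputable def Qproj {n : ℕ} {ι : Type*} [Fintype ι]
    (α : ℝ) (X : ι → Matrix (Fin n) (Fin n) ℂ) (ρ : Matrix (Fin n) (Fin n) ℂ) : EReal :=
  ⨅ σ : {σ : Matrix (Fin n) (Fin n) ℂ // IsDensity σ}, Dren α ρ (pinch X σ.1)

/-- von Neumann entropy `H(ρ) = -Tr[ρ log ρ]`. -/
noncomputable def vnEnt {m : Type*} [Fintype m] [DecidableEq m] (ρ : Matrix m m ℂ) : ℝ :=
  - ((ρ * mlog ρ).trace).re

/-- A Naimark extension of a POVM `X` on `ℂ^n`: an isometry `V : ℂ^n → ℂ^m` together with a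
projective observable `X̃` on `ℂ^m` with `X_x = V† X̃_x V` (i.e. `X_x = P X̃_x P` under the
identification of `ℂ^n` with its image). -/
structure Naimark (n m : ℕ) {ι : Type*} [Fintype ι]
    (X : ι → Matrix (Fin n) (Fin n) ℂ) where
  V : Matrix (Fin m) (Fin n) ℂ
  isometry : Vᴴ * V = 1
  Xt : ι → Matrix (Fin m) (Fin m) ℂ
  projective : IsProjective Xt
  sum_eq : ∑ x, Xt x = 1
  compat : ∀ x, X x = Vᴴ * Xt x * V

/-- Rényi asymmetry of an arbitrary discrete observable relative to a fixed Naimark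
extension: `Q_α(X|ρ) = inf_σ D_α(ρ ‖ σ_X̃)` over density matrices `σ` on `ℂ^n`
(regarded as matrices on `ℂ^m`). -/
noncomputable def Qnaimark {n m : ℕ} {ι : Type*} [Fintype ι]
    {X : ι → Matrix (Fin n) (Fin n) ℂ} (α : ℝ) (E : Naimark n m X)
    (ρ : Matrix (Fin n) (Fin n) ℂ) : EReal :=
  ⨅ σ : {σ : Matrix (Fin n) (Fin n) ℂ // IsDensity σ},
    Dren α (E.V * ρ * E.Vᴴ) (pinch E.Xt (E.V * σ.1 * E.Vᴴ))

lemma eigs_of_isHermitian {m : Type*} [Fintype m] [DecidableEq m] {A : Matrix m m ℂ}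
    (hA : A.IsHermitian) : eigs A = hA.eigenvalues :=
  dif_pos hA

lemma eigs_le_lamMax {m : Type*} [Fintype m] [DecidableEq m] (A : Matrix m m ℂ) (i : m) :
    eigs A i ≤ lamMax A :=
  le_ciSup (Set.finite_range _).bddAbove i

lemma lamMax_nonneg {m : Type*} [Fintype m] [DecidableEq m] {A : Matrix m m ℂ}
    (hA : A.PosSemidef) : 0 ≤ lamMax A :=
  Real.iSup_nonneg fun i => by
    rw [eigs_of_isHermitian hA.isHermitian]
    exact hA.eigenvalues_nonneg i

/-- `A ≤ λ_max(A) 𝟙` in the Loewner order. -/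
lemma posSemidef_lamMax_smul_one_sub {m : Type*} [Fintype m] [DecidableEq m] {A : Matrix m m ℂ}
    (hA : A.IsHermitian) : ((lamMax A : ℂ) • (1 : Matrix m m ℂ) - A).PosSemidef := by
  obtain ⟨U, hU⟩ : ∃ U : Matrix m m ℂ, U = (hA.eigenvectorUnitary : Matrix m m ℂ) := ⟨_, rfl⟩
  have hUU : U * Uᴴ = 1 := by
    rw [hU]
    exact Unitary.coe_mul_star_self hA.eigenvectorUnitary
  have hspec : A = U * diagonal (fun i => (hA.eigenvalues i : ℂ)) * Uᴴ := by
    conv_lhs => rw [hA.spectral_theorem]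
    rw [hU]
    rfl
  have hD : (diagonal (fun i => ((lamMax A - hA.eigenvalues i : ℝ) : ℂ))).PosSemidef := by
    refine PosSemidef.diagonal fun i => ?_
    have h := eigs_le_lamMax A i
    rw [eigs_of_isHermitian hA] at h
    exact Complex.zero_le_real.mpr (sub_nonneg.mpr h)
  have hdiag : diagonal (fun i => ((lamMax A - hA.eigenvalues i : ℝ) : ℂ))
      = (lamMax A : ℂ) • (1 : Matrix m m ℂ) - diagonal (fun i => (hA.eigenvalues i : ℂ)) := by
    rw [smul_one_eq_diagonal, diagonal_sub]
    simp
  have h := hD.mul_mul_conjTranspose_same U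
  rw [hdiag, mul_sub, sub_mul, ← hspec, mul_smul_comm, smul_mul_assoc, mul_one, hUU] at h
  exact h

/-- For a projection `E`, `Tr[E X] ≤ λ_max(E X E) Tr[E]`. -/
lemma re_trace_mul_le_lamMax_mul {m : Type*} [Fintype m] [DecidableEq m] {E X : Matrix m m ℂ}
    (hE : E.IsHermitian) (hEE : E * E = E) (hX : X.IsHermitian) :
    (E * X).trace.re ≤ lamMax (E * X * E) * E.trace.re := by
  have hA : (E * X * E).IsHermitian := by
    simpa only [hE.eq] using isHermitian_mul_mul_conjTranspose E hX
  have h := ((posSemidef_lamMax_smul_one_sub hA).mul_mul_conjTranspose_same E).trace_nonneg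
  have h1 : E * (E * X * E) * E = E * X * E := by
    rw [mul_assoc, mul_assoc (E * X), hEE, ← mul_assoc, ← mul_assoc, hEE]
  have h2 : (E * X * E).trace = (E * X).trace := by
    rw [trace_mul_comm, ← mul_assoc, hEE]
  rw [hE.eq, mul_sub, sub_mul, h1, mul_smul_comm, smul_mul_assoc, mul_one, hEE, trace_sub,
    trace_smul, h2] at h
  have := (Complex.le_def.mp h).1
  simpa using this

/-- A matrix with `A² = p A`, `p ≥ 0`, has no eigenvalue above `p`. -/
lemma lamMax_le_of_mul_self_eq_smul {m : Type*} [Fintype m] [DecidableEq m] {A : Matrix m m ℂ}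
    {p : ℝ} (hp : 0 ≤ p) (hAA : A * A = (p : ℂ) • A) : lamMax A ≤ p := by
  refine Real.iSup_le (fun i => ?_) hp
  by_cases hA : A.IsHermitian
  · rw [eigs_of_isHermitian hA]
    set v : m → ℂ := ⇑(hA.eigenvectorBasis i) with hv
    have hAv : A *ᵥ v = (hA.eigenvalues i : ℂ) • v := by
      rw [hv, hA.mulVec_eigenvectorBasis i]
      rfl
    have hv0 : v ≠ 0 := fun h =>
      hA.eigenvectorBasis.orthonormal.ne_zero i (by ext k; exact congrFun h k)
    have h : A *ᵥ (A *ᵥ v) = (p : ℂ) • (A *ᵥ v) := by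
      rw [mulVec_mulVec, hAA, smul_mulVec]
    rw [hAv, mulVec_smul, hAv, smul_smul, smul_smul] at h
    have h' : hA.eigenvalues i * hA.eigenvalues i = p * hA.eigenvalues i := by
      exact_mod_cast smul_left_injective ℂ hv0 h
    by_contra! hlt
    nlinarith
  · simp [eigs, hA, hp]

lemma vecMulVec_mul_mul_vecMulVec {m : Type*} [Fintype m] (u v : m → ℂ) (X : Matrix m m ℂ) :
    vecMulVec u v * X * vecMulVec u v = (vecMulVec u v * X).trace • vecMulVec u v := by
  rw [vecMulVec_mul, vecMulVec_mul_vecMulVec, trace_vecMulVec, dotProduct_comm u, vecMulVec_smul]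

lemma trace_mul_nonneg_of_pure {m : Type*} [Fintype m] [DecidableEq m] {ρ Y : Matrix m m ℂ}
    {ψ : m → ℂ} (hρ : IsDensity ρ) (hY : Y.PosSemidef) (hψ : ρ = vecMulVec ψ (star ψ)) :
    0 ≤ (ρ * Y).trace := by
  have h := (hY.mul_mul_conjTranspose_same ρ).trace_nonneg
  rwa [hρ.1.isHermitian.eq, hψ, vecMulVec_mul_mul_vecMulVec, ← hψ, trace_smul, hρ.2, smul_eq_mul,
    mul_one] at h

section SpectralDecomposition

variable {m J : Type*} [Fintype m] [DecidableEq m] [Fintype J]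
  {ρ : Matrix m m ℂ} {e : J → ℝ} {Epr : J → Matrix m m ℂ}

lemma IsProjective.mul_self (hE : IsProjective Epr) (j : J) : Epr j * Epr j = Epr j := by
  simpa using hE.2 j j

lemma IsProjective.posSemidef (hE : IsProjective Epr) (j : J) : (Epr j).PosSemidef := by
  have h := posSemidef_conjTranspose_mul_self (Epr j)
  rwa [(hE.1 j).eq, hE.mul_self] at h

lemma spectral_mul_proj (hE : IsProjective Epr) (hspec : ρ = ∑ j, (e j : ℂ) • Epr j) (j : J) :
    ρ * Epr j = (e j : ℂ) • Epr j := by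
  simp [hspec, Finset.sum_mul, hE.2]

lemma proj_mul_spectral (hE : IsProjective Epr) (hspec : ρ = ∑ j, (e j : ℂ) • Epr j) (j : J) :
    Epr j * ρ = (e j : ℂ) • Epr j := by
  simp [hspec, Finset.mul_sum, hE.2]

lemma proj_eq_zero_of_neg (hρ : ρ.PosSemidef) (hE : IsProjective Epr)
    (hspec : ρ = ∑ j, (e j : ℂ) • Epr j) {j : J} (hj : e j < 0) : Epr j = 0 := by
  have h := (hρ.mul_mul_conjTranspose_same (Epr j)).trace_nonneg
  rw [(hE.1 j).eq, proj_mul_spectral hE hspec, smul_mul_assoc, hE.mul_self, trace_smul] at h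
  have h0 := (hE.posSemidef j).trace_nonneg
  rw [← (hE.posSemidef j).trace_eq_zero_iff]
  rw [Complex.le_def] at h h0
  simp only [smul_eq_mul, Complex.mul_re, Complex.ofReal_re, Complex.ofReal_im, zero_mul,
    sub_zero, Complex.zero_re, Complex.zero_im] at h h0
  exact Complex.ext (by simp only [Complex.zero_re]; nlinarith) h0.2.symm

/-- `Tr[ρ X_x]` is at most any nonnegative bound on the `λ_max(E_j X_x E_j)` with `e_j > 0`. -/
lemma probOf_le_of_lamMax_le {ι : Type*} {X : ι → Matrix m m ℂ} {x : ι} {S : ℝ}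
    (hρ : IsDensity ρ) (hE : IsProjective Epr) (hspec : ρ = ∑ j, (e j : ℂ) • Epr j)
    (hX : (X x).IsHermitian) (hS : ∀ j, 0 < e j → lamMax (Epr j * X x * Epr j) ≤ S) :
    probOf ρ X x ≤ S := by
  have htr : ∑ j, e j * (Epr j).trace.re = 1 := by
    have h := congrArg Complex.re hρ.2
    simpa [hspec, trace_sum] using h
  have hterm (j : J) : e j * (Epr j * X x).trace.re ≤ S * (e j * (Epr j).trace.re) := by
    rcases lt_trichotomy (e j) 0 with hj | hj | hj
    · simp [proj_eq_zero_of_neg hρ.1 hE hspec hj]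
    · simp [hj]
    · have h0 : 0 ≤ (Epr j).trace.re := (Complex.le_def.mp (hE.posSemidef j).trace_nonneg).1
      calc e j * (Epr j * X x).trace.re
          ≤ e j * (lamMax (Epr j * X x * Epr j) * (Epr j).trace.re) :=
            mul_le_mul_of_nonneg_left
              (re_trace_mul_le_lamMax_mul (hE.1 j) (hE.mul_self j) hX) hj.le
        _ ≤ e j * (S * (Epr j).trace.re) := by gcongr; exact hS j hj
        _ = S * (e j * (Epr j).trace.re) := by ring
  calc probOf ρ X x = ∑ j, e j * (Epr j * X x).trace.re := by
        simp [probOf, hspec, Finset.sum_mul, trace_sum]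
    _ ≤ ∑ j, S * (e j * (Epr j).trace.re) := Finset.sum_le_sum fun j _ => hterm j
    _ = S := by rw [← Finset.mul_sum, htr, mul_one]

/-- For a pure state, every `λ_max(E_j X_x E_j)` with `e_j > 0` is at most `Tr[ρ X_x]`. -/
lemma lamMax_le_probOf_of_pure {ι : Type*} {X : ι → Matrix m m ℂ} {x : ι} {ψ : m → ℂ}
    (hρ : IsDensity ρ) (hE : IsProjective Epr) (hspec : ρ = ∑ j, (e j : ℂ) • Epr j)
    (hX : (X x).PosSemidef) (hψ : ρ = vecMulVec ψ (star ψ)) {j : J} (hj : 0 < e j) :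
    lamMax (Epr j * X x * Epr j) ≤ probOf ρ X x := by
  have hcomp (Y : Matrix m m ℂ) : ρ * Y * ρ = (ρ * Y).trace • ρ := by
    rw [hψ, vecMulVec_mul_mul_vecMulVec]
  have hρρ : ρ * ρ = ρ := by simpa [hρ.2] using hcomp 1
  have hnonneg := trace_mul_nonneg_of_pure hρ hX hψ
  have hp : ((probOf ρ X x : ℝ) : ℂ) = (ρ * X x).trace :=
    Complex.ext rfl (Complex.le_def.mp hnonneg).2
  have hfix : (e j : ℂ) • Epr j = Epr j := by
    have h : ρ * (ρ * Epr j) = ρ * Epr j := by rw [← mul_assoc, hρρ]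
    rw [spectral_mul_proj hE hspec, mul_smul_comm, spectral_mul_proj hE hspec] at h
    exact smul_right_injective _ (Complex.ofReal_ne_zero.mpr hj.ne') h
  have hl : Epr j * ρ = Epr j := by rw [proj_mul_spectral hE hspec, hfix]
  have hr : ρ * Epr j = Epr j := by rw [spectral_mul_proj hE hspec, hfix]
  have hA : Epr j * X x * Epr j = (probOf ρ X x : ℂ) • Epr j := by
    calc Epr j * X x * Epr j = Epr j * (ρ * X x * ρ) * Epr j := by
          rw [← mul_assoc, ← mul_assoc, hl, mul_assoc (Epr j * X x), hr]
      _ = (probOf ρ X x : ℂ) • Epr j := by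
          rw [hcomp, mul_smul_comm, hl, smul_mul_assoc, hE.mul_self, hp]
  refine lamMax_le_of_mul_self_eq_smul (Complex.le_def.mp hnonneg).1 ?_
  rw [hA, smul_mul_assoc, mul_smul_comm, hE.mul_self]

end SpectralDecomposition

/-- `max_x Tr[ρX_x] ≤ max_{x, j : e_j > 0} λ_max(E_j X_x E_j)` for the
spectral projections `E_j` of `ρ`; i.e. the incompatibility lower bound for the Rényi
entropy never exceeds the min-entropy `H_∞(X|ρ)`, with equality when `ρ` is pure. -/
theorem spectral_bound_le_min_entropy_bound
    {n : ℕ} {ι J : Type*} [Fintype ι] [Fintype J]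
    (ρ : Matrix (Fin n) (Fin n) ℂ) (hρ : IsDensity ρ)
    (X : ι → Matrix (Fin n) (Fin n) ℂ) (hX : IsPOVM X)
    (e : J → ℝ) (Epr : J → Matrix (Fin n) (Fin n) ℂ)
    (hE : IsProjective Epr) (hEsum : ∑ j, Epr j = 1)
    (hinj : Function.Injective e)
    (hspec : ρ = ∑ j, (e j : ℂ) • Epr j) :
    (⨆ x, probOf ρ X x)
      ≤ (⨆ x, ⨆ j, ⨆ (_ : 0 < e j), lamMax (Epr j * X x * Epr j)) ∧
    (∀ ψ : Fin n → ℂ, ρ = vecMulVec ψ (star ψ) →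
      (⨆ x, probOf ρ X x)
        = (⨆ x, ⨆ j, ⨆ (_ : 0 < e j), lamMax (Epr j * X x * Epr j))) := by
  have hpsd (x : ι) (j : J) : (Epr j * X x * Epr j).PosSemidef := by
    simpa only [(hE.1 j).eq] using (hX.1 x).mul_mul_conjTranspose_same (Epr j)
  have hS0 : 0 ≤ ⨆ x, ⨆ j, ⨆ (_ : 0 < e j), lamMax (Epr j * X x * Epr j) :=
    Real.iSup_nonneg fun x => Real.iSup_nonneg fun j => Real.iSup_nonneg fun _ =>
      lamMax_nonneg (hpsd x j)
  have hle : (⨆ x, probOf ρ X x)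
      ≤ ⨆ x, ⨆ j, ⨆ (_ : 0 < e j), lamMax (Epr j * X x * Epr j) := by
    refine Real.iSup_le (fun x => ?_) hS0
    refine probOf_le_of_lamMax_le hρ hE hspec (hX.1 x).isHermitian fun j hj => ?_
    calc lamMax (Epr j * X x * Epr j)
        = ⨆ (_ : 0 < e j), lamMax (Epr j * X x * Epr j) := by rw [ciSup_pos hj]
      _ ≤ ⨆ j, ⨆ (_ : 0 < e j), lamMax (Epr j * X x * Epr j) :=
          le_ciSup (f := fun j => ⨆ (_ : 0 < e j), lamMax (Epr j * X x * Epr j))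
            (Set.finite_range _).bddAbove j
      _ ≤ _ := le_ciSup (f := fun x => ⨆ j, ⨆ (_ : 0 < e j), lamMax (Epr j * X x * Epr j))
            (Set.finite_range _).bddAbove x
  refine ⟨hle, fun ψ hψ => le_antisymm hle ?_⟩
  have hp0 (x : ι) : 0 ≤ probOf ρ X x :=
    (Complex.le_def.mp (trace_mul_nonneg_of_pure hρ (hX.1 x) hψ)).1
  refine Real.iSup_le (fun x => ?_) (Real.iSup_nonneg hp0)
  refine le_trans ?_ (le_ciSup (Set.finite_range (probOf ρ X)).bddAbove x)
  exact Real.iSup_le (fun j => Real.iSup_le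
    (fun hj => lamMax_le_probOf_of_pure hρ hE hspec (hX.1 x) hψ hj) (hp0 x)) (hp0 x)

end QC
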